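/- There exists N such that for every n ≥ N the following holds in the (1,4,n)-LRM scheme: for every word g' = (g_0, …, g_{n-4}) over {0,1,2,3} of length n-3 that contains (3,3,0,1,2,1) as a contiguous subsequence, there are at least 4^3 = 64 distinct legal codewords g of length n whose first n-3 symbols equal g'. -/

import Mathlib

/-- A cyclic charge sequence `c : ZMod n → ℤ` has pairwise distinct values in every
window of four cyclically consecutive cells. -/
def DistinctWindows4 (n : ℕ) (c : ZMod n → ℤ) : Prop :=
  ∀ i : ZMod n, ∀ k l : Fin 4, k ≠ l →
    c (i + ((k : ℕ) : ZMod n)) ≠ c (i + ((l : ℕ) : ZMod n))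

/-- A word `g` of length `n` over `{0,1,2,3}` is a legal codeword in the `(1,4,n)`-LRM
scheme: it is induced by some charge sequence `c` with pairwise distinct values in each
window of four cyclically consecutive cells, via
`g i = |{ j ∈ {i, i+1, i+2} : c j < c (i+3) }|`. -/
def LegalCodeword4 (n : ℕ) (g : ZMod n → Fin 4) : Prop :=
  ∃ c : ZMod n → ℤ, DistinctWindows4 n c ∧
    ∀ i : ZMod n,
      (g i : ℕ) =
        (Finset.univ.filter (fun j : Fin 3 => c (i + ((j : ℕ) : ZMod n)) < c (i + 3))).card

/-- The word `s` of length `m` over the alphabet `{0,1,2,3}` contains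
`(3,3,0,1,2,1)` as a contiguous subsequence. -/
def Contains330121 {m : ℕ} (s : Fin m → Fin 4) : Prop :=
  ∃ i : ℕ, ∃ h : i + 5 < m,
    s ⟨i, by omega⟩ = 3 ∧ s ⟨i + 1, by omega⟩ = 3 ∧
    s ⟨i + 2, by omega⟩ = 0 ∧ s ⟨i + 3, by omega⟩ = 1 ∧
    s ⟨i + 4, by omega⟩ = 2 ∧ s ⟨i + 5, h⟩ = 1

def Win4 (v : Fin 4) (x y z t : ℚ) : Prop :=
  x ≠ t ∧ y ≠ t ∧ z ≠ t ∧
    (v : ℕ) = (if x < t then 1 else 0) + (if y < t then 1 else 0) + (if z < t then 1 else 0)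

lemma win4_sorted (v : Fin 4) (x y z : ℚ) (h1 : x < y) (h2 : y < z) :
    ∃ t, Win4 v x y z t := by
  unfold Win4
  fin_cases v
  · refine ⟨x - 1, ?_⟩; grind
  · refine ⟨(x + y) / 2, ?_⟩; grind
  · refine ⟨(y + z) / 2, ?_⟩; grind
  · refine ⟨z + 1, ?_⟩; grind

lemma win4_exists (v : Fin 4) (x y z : ℚ) :
    ∃ t, x ≠ y → x ≠ z → y ≠ z → Win4 v x y z t := by
  by_cases h : x ≠ y ∧ x ≠ z ∧ y ≠ z
  · obtain ⟨h1, h2, h3⟩ := h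
    have key : ∃ t, Win4 v x y z t := by
      rcases lt_or_gt_of_ne h1 with a | a <;> rcases lt_or_gt_of_ne h2 with b | b <;>
        rcases lt_or_gt_of_ne h3 with c | c
      · exact win4_sorted v x y z a c
      · obtain ⟨t, ht⟩ := win4_sorted v x z y b c
        exact ⟨t, by unfold Win4 at *; grind⟩
      · linarith
      · obtain ⟨t, ht⟩ := win4_sorted v z x y b a
        exact ⟨t, by unfold Win4 at *; grind⟩
      · obtain ⟨t, ht⟩ := win4_sorted v y x z a b
        exact ⟨t, by unfold Win4 at *; grind⟩
      · linarith
      · obtain ⟨t, ht⟩ := win4_sorted v y z x c b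
        exact ⟨t, by unfold Win4 at *; grind⟩
      · obtain ⟨t, ht⟩ := win4_sorted v z y x c a
        exact ⟨t, by unfold Win4 at *; grind⟩
    obtain ⟨t, ht⟩ := key
    exact ⟨t, fun _ _ _ => ht⟩
  · exact ⟨0, fun a b c => absurd ⟨a, b, c⟩ h⟩

lemma greedy4 (h : ℕ → Fin 4) : ∃ a : ℕ → ℚ, a 0 = 1 ∧ a 1 = 2 ∧ a 2 = 0 ∧
    ∀ k, Win4 (h k) (a k) (a (k+1)) (a (k+2)) (a (k+3)) := by
  choose f hf using win4_exists
  let s : ℕ → ℚ × ℚ × ℚ := fun k => Nat.rec (1, 2, 0)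
    (fun k p => (p.2.1, p.2.2, f (h k) p.1 p.2.1 p.2.2)) k
  have hs : ∀ k, s (k+1) = ((s k).2.1, (s k).2.2, f (h k) (s k).1 (s k).2.1 (s k).2.2) :=
    fun k => rfl
  have e1 : ∀ k, (s (k+1)).1 = (s k).2.1 := fun k => rfl
  have e2 : ∀ k, (s (k+2)).1 = (s k).2.2 := fun k => rfl
  have e3 : ∀ k, (s (k+3)).1 = f (h k) (s k).1 (s k).2.1 (s k).2.2 := fun k => rfl
  have hd : ∀ k, (s k).1 ≠ (s k).2.1 ∧ (s k).1 ≠ (s k).2.2 ∧ (s k).2.1 ≠ (s k).2.2 := by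
    intro k
    induction k with
    | zero => simp [s]
    | succ k ih =>
      obtain ⟨a, b, c⟩ := ih
      obtain ⟨_, w2, w3, _⟩ := hf (h k) _ _ _ a b c
      rw [hs]
      exact ⟨c, w2, w3⟩
  refine ⟨fun k => (s k).1, rfl, rfl, rfl, fun k => ?_⟩
  show Win4 _ (s k).1 (s (k+1)).1 (s (k+2)).1 (s (k+3)).1
  rw [e1, e2, e3]
  exact hf _ _ _ _ (hd k).1 (hd k).2.1 (hd k).2.2

lemma legal_of_rat (n : ℕ) [NeZero n] (g : ZMod n → Fin 4) (c : ZMod n → ℚ)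
    (hc : ∀ i, Win4 (g i) (c i) (c (i+1)) (c (i+2)) (c (i+3))) : LegalCodeword4 n g := by
  let r : ZMod n → ℤ := fun x => ((Finset.univ.filter (fun y => c y < c x)).card : ℤ)
  have hlt : ∀ x y, c x < c y → r x < r y := by
    intro x y hxy
    simp only [r, Nat.cast_lt]
    apply Finset.card_lt_card
    rw [Finset.ssubset_iff_of_subset]
    · exact ⟨x, by simp [hxy], by simp⟩
    · intro z hz
      simp only [Finset.mem_filter, Finset.mem_univ, true_and] at hz ⊢
      exact hz.trans hxy
  have heq : ∀ x y, c x = c y → r x = r y := by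
    intro x y hxy
    simp only [r, hxy]
  have hiff : ∀ x y, r x < r y ↔ c x < c y := by
    intro x y
    refine ⟨fun h => ?_, hlt x y⟩
    rcases lt_trichotomy (c x) (c y) with a | a | a
    · exact a
    · have := heq _ _ a; omega
    · have := hlt _ _ a; omega
  have hne : ∀ x y, c x ≠ c y → r x ≠ r y := by
    intro x y h
    rcases lt_or_gt_of_ne h with a | a
    · exact (hlt _ _ a).ne
    · exact (hlt _ _ a).ne'
  refine ⟨r, ?_, ?_⟩
  · intro i k l hkl
    apply hne
    have w0 := hc i
    have w1 := hc (i - 1)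
    have w2 := hc (i - 2)
    rw [show i - 1 + 1 = i by ring, show i - 1 + 2 = i + 1 by ring,
      show i - 1 + 3 = i + 2 by ring] at w1
    rw [show i - 2 + 1 = i - 1 by ring, show i - 2 + 2 = i by ring,
      show i - 2 + 3 = i + 1 by ring] at w2
    obtain ⟨x1, x2, x3, _⟩ := w0
    obtain ⟨_, y2, y3, _⟩ := w1
    obtain ⟨_, _, z3, _⟩ := w2
    fin_cases k <;> fin_cases l <;> simp at hkl ⊢ <;> first | assumption | (apply Ne.symm; assumption)
  · intro i
    rw [(hc i).2.2.2, Finset.card_filter, Fin.sum_univ_three]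
    simp [hiff]

lemma legal_of_pattern (n : ℕ) (hn : 9 ≤ n) (g : ZMod n → Fin 4) (p : ZMod n)
    (h0 : g p = 3) (h1 : g (p+1) = 3) (h2 : g (p+2) = 0) (h3 : g (p+3) = 1)
    (h4 : g (p+4) = 2) (h5 : g (p+5) = 1) : LegalCodeword4 n g := by
  haveI : NeZero n := ⟨by omega⟩
  obtain ⟨a, a0, a1, a2, ha⟩ := greedy4 (fun k => g (p + 6 + k))
  obtain ⟨M, hM⟩ : ∃ M : ℚ, ∀ k < n, a k < M ∧ -M < a k := by
    refine ⟨∑ k ∈ Finset.range n, |a k| + 1, fun k hk => ?_⟩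
    have := Finset.single_le_sum (f := fun k => |a k|) (fun i _ => abs_nonneg (a i))
      (Finset.mem_range.2 hk)
    have := abs_le.1 this
    constructor <;> linarith
  let b : ℕ → ℚ := fun k => if k < n - 3 then a k else if k = n - 3 then M else
    if k = n - 2 then M + 1 else -M
  have hb : ∀ k, k < n - 3 → b k = a k := fun k hk => by simp [b, hk]
  have hb1 : b (n - 3) = M := by simp [b]
  have hb2 : b (n - 2) = M + 1 := by
    simp only [b]; rw [if_neg (by omega), if_neg (by omega), if_pos trivial]
  have hb3 : b (n - 1) = -M := by
    simp only [b]; rw [if_neg (by omega), if_neg (by omega), if_neg (by omega)]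
  let c : ZMod n → ℚ := fun x => b (x - (p + 6)).val
  have hcB : ∀ k : ℕ, c (p + 6 + k) = b (k % n) := by
    intro k
    simp only [c]
    rw [add_sub_cancel_left, ZMod.val_natCast]
  apply legal_of_rat n g c
  intro i
  obtain ⟨k, hk, rfl⟩ : ∃ k : ℕ, k < n ∧ p + 6 + (k : ZMod n) = i :=
    ⟨(i - (p + 6)).val, ZMod.val_lt _, by rw [ZMod.natCast_zmod_val]; ring⟩
  have s1 : p + 6 + (k : ZMod n) + 1 = p + 6 + ((k + 1 : ℕ) : ZMod n) := by push_cast; ring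
  have s2 : p + 6 + (k : ZMod n) + 2 = p + 6 + ((k + 2 : ℕ) : ZMod n) := by push_cast; ring
  have s3 : p + 6 + (k : ZMod n) + 3 = p + 6 + ((k + 3 : ℕ) : ZMod n) := by push_cast; ring
  rw [s1, s2, s3, hcB, hcB, hcB, hcB]
  have lo : ∀ m, m < n → m % n = m := fun m hm => Nat.mod_eq_of_lt hm
  have hi : ∀ m, n ≤ m → m < n + n → m % n = m - n := fun m h1 h2 => by
    rw [Nat.mod_eq_sub_mod h1, Nat.mod_eq_of_lt (by omega)]
  by_cases hk6 : k + 3 < n - 3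
  · rw [lo k, lo (k+1), lo (k+2), lo (k+3), hb, hb, hb, hb] <;> first | omega | exact ha k
  have hnn : ((n : ℕ) : ZMod n) = 0 := ZMod.natCast_self n
  have hg : ∀ j : ℕ, k + 6 = n + j → p + 6 + (k : ZMod n) = p + j := by
    intro j hj
    have : ((k + 6 : ℕ) : ZMod n) = ((n + j : ℕ) : ZMod n) := by rw [hj]
    push_cast at this
    rw [hnn, zero_add] at this
    rw [← this]; ring
  have m0 := hM 0 (by omega)
  have m1 := hM 1 (by omega)
  have m2 := hM 2 (by omega)
  rw [a0] at m0
  rw [a1] at m1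
  rw [a2] at m2
  have b0 : b 0 = 1 := by rw [hb 0 (by omega), a0]
  have b1 : b 1 = 2 := by rw [hb 1 (by omega), a1]
  have b2 : b 2 = 0 := by rw [hb 2 (by omega), a2]
  have q4 := hM (n - 4) (by omega)
  have q5 := hM (n - 5) (by omega)
  have q6 := hM (n - 6) (by omega)
  rw [← hb _ (by omega)] at q4 q5 q6
  have hcase : k = n - 6 ∨ k = n - 5 ∨ k = n - 4 ∨ k = n - 3 ∨ k = n - 2 ∨ k = n - 1 := by omega
  rcases hcase with e | e | e | e | e | e
  · have w := hg 0 (by omega)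
    rw [w, lo k (by omega), lo (k+1) (by omega), lo (k+2) (by omega), lo (k+3) (by omega),
      show k + 1 = n - 5 by omega, show k + 2 = n - 4 by omega, show k + 3 = n - 3 by omega, e, hb1]
    simp only [Nat.cast_zero, add_zero, h0, Win4]
    rw [if_pos (by linarith), if_pos (by linarith), if_pos (by linarith)]
    exact ⟨by linarith [q6.1] |> fun h : b (n-6) < M => h.ne, q5.1.ne, q4.1.ne, rfl⟩
  · have w := hg 1 (by omega)
    rw [w, lo k (by omega), lo (k+1) (by omega), lo (k+2) (by omega), lo (k+3) (by omega),
      show k + 1 = n - 4 by omega, show k + 2 = n - 3 by omega, show k + 3 = n - 2 by omega, e,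
      hb1, hb2]
    simp only [Nat.cast_one, h1, Win4]
    rw [if_pos (by linarith), if_pos (by linarith), if_pos (by linarith)]
    exact ⟨ne_of_lt (by linarith), ne_of_lt (by linarith), ne_of_lt (by linarith), rfl⟩
  · have w := hg 2 (by omega)
    rw [w, lo k (by omega), lo (k+1) (by omega), lo (k+2) (by omega), lo (k+3) (by omega),
      show k + 1 = n - 3 by omega, show k + 2 = n - 2 by omega, show k + 3 = n - 1 by omega, e,
      hb1, hb2, hb3]
    simp only [Nat.cast_ofNat, h2, Win4]
    rw [if_neg (by linarith), if_neg (by linarith), if_neg (by linarith)]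
    exact ⟨ne_of_gt (by linarith), ne_of_gt (by linarith), ne_of_gt (by linarith), rfl⟩
  · have w := hg 3 (by omega)
    rw [w, lo k (by omega), lo (k+1) (by omega), lo (k+2) (by omega), hi (k+3) (by omega) (by omega),
      show k + 1 = n - 2 by omega, show k + 2 = n - 1 by omega, show k + 3 - n = 0 by omega, e,
      hb1, hb2, hb3, b0]
    simp only [Nat.cast_ofNat, h3, Win4]
    rw [if_neg (by linarith), if_neg (by linarith), if_pos (by linarith)]
    exact ⟨ne_of_gt (by linarith), ne_of_gt (by linarith), ne_of_lt (by linarith), rfl⟩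
  · have w := hg 4 (by omega)
    rw [w, lo k (by omega), lo (k+1) (by omega), hi (k+2) (by omega) (by omega),
      hi (k+3) (by omega) (by omega),
      show k + 1 = n - 1 by omega, show k + 2 - n = 0 by omega, show k + 3 - n = 1 by omega, e,
      hb2, hb3, b0, b1]
    simp only [Nat.cast_ofNat, h4, Win4]
    rw [if_neg (by linarith), if_pos (by linarith), if_pos (by linarith)]
    exact ⟨ne_of_gt (by linarith), ne_of_lt (by linarith), ne_of_lt (by linarith), rfl⟩
  · have w := hg 5 (by omega)
    rw [w, lo k (by omega), hi (k+1) (by omega) (by omega), hi (k+2) (by omega) (by omega),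
      hi (k+3) (by omega) (by omega),
      show k + 1 - n = 0 by omega, show k + 2 - n = 1 by omega, show k + 3 - n = 2 by omega, e,
      hb3, b0, b1, b2]
    simp only [Nat.cast_ofNat, h5, Win4]
    rw [if_pos (by linarith), if_neg (by linarith), if_neg (by linarith)]
    exact ⟨ne_of_lt (by linarith), ne_of_gt (by linarith), ne_of_gt (by linarith), rfl⟩

/-- For all sufficiently large `n`: every word of length `n - 3` over `{0,1,2,3}`
containing `(3,3,0,1,2,1)` as a contiguous subsequence extends to at least `64`
distinct legal codewords of the `(1,4,n)`-LRM scheme. -/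
theorem sixtyfour_extensions_of_pattern_words :
    ∃ N : ℕ, ∀ n : ℕ, N ≤ n →
      ∀ g' : Fin (n - 3) → Fin 4, Contains330121 g' →
        64 ≤ Nat.card {g : ZMod n → Fin 4 //
              LegalCodeword4 n g ∧ ∀ i : Fin (n - 3), g ((i : ℕ) : ZMod n) = g' i} := by
  refine ⟨9, fun n hn g' hg' => ?_⟩
  haveI : NeZero n := ⟨by omega⟩
  obtain ⟨i, hi, e0, e1, e2, e3, e4, e5⟩ := hg'
  let G : (Fin 3 → Fin 4) → ZMod n → Fin 4 := fun f x =>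
    if h : x.val < n - 3 then g' ⟨x.val, h⟩ else
      f ⟨x.val - (n - 3), by have := ZMod.val_lt x; omega⟩
  have hG : ∀ f (k : ℕ) (hk : k < n - 3), G f (k : ZMod n) = g' ⟨k, hk⟩ := by
    intro f k hk
    have hv : ((k : ZMod n)).val = k := ZMod.val_cast_of_lt (by omega)
    simp only [G, hv, hk, dite_true]
  have hG2 : ∀ f (j : Fin 3), G f ((n - 3 + j : ℕ) : ZMod n) = f j := by
    intro f j
    have hv : (((n - 3 + j : ℕ) : ZMod n)).val = n - 3 + j := ZMod.val_cast_of_lt (by omega)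
    simp only [G]
    rw [dif_neg (by omega)]
    congr 1
    apply Fin.ext
    simp only [hv]
    omega
  let F : (Fin 3 → Fin 4) → {g : ZMod n → Fin 4 //
              LegalCodeword4 n g ∧ ∀ i : Fin (n - 3), g ((i : ℕ) : ZMod n) = g' i} := fun f =>
    ⟨G f, by
      refine ⟨?_, fun j => hG f j j.2⟩
      have t := fun (j : ℕ) (hj : i + j < n - 3) => hG f (i + j) hj
      apply legal_of_pattern n hn (G f) (i : ZMod n)
      · rw [hG f i (by omega), e0]
      · have := t 1 (by omega); push_cast at this; rw [this, e1]
      · have := t 2 (by omega); push_cast at this; rw [this, e2]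
      · have := t 3 (by omega); push_cast at this; rw [this, e3]
      · have := t 4 (by omega); push_cast at this; rw [this, e4]
      · have := t 5 (by omega); push_cast at this; rw [this, e5]⟩
  have hF : Function.Injective F := by
    intro f f' h
    have h' : G f = G f' := congrArg Subtype.val h
    funext j
    rw [← hG2 f j, ← hG2 f' j, h']
  have := Nat.card_le_card_of_injective F hF
  simpa using this
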